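/- For every real ξ ≠ 0 one has: Φ(s,ξ) < 0 for every s with 0 < s < λ_c(ξ); Φ(s,ξ) ≥ 0 for every s ≥ λ_c(ξ); and Φ(λ_c(ξ), ξ) = 0. -/

import Mathlib

open Real MeasureTheory Set

noncomputable section

/-- The function `r ↦ r W(r)`. -/
def rW (W : ℝ → ℝ) : ℝ → ℝ := fun r => r * W r

/-- The functional `E₁(ξ,W) = ∫_I [ξ² r ρ̄ W² + r ρ̄ |D(rW)|²] dr`. -/
def E1fun (R₁ R₂ : ℝ) (ρ : ℝ → ℝ) (ξ : ℝ) (W : ℝ → ℝ) : ℝ :=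
  ∫ r in R₁..R₂, (ξ ^ 2 * r * ρ r * (W r) ^ 2 + r * ρ r * (deriv (rW W) r) ^ 2)

/-- The functional `E₂(ξ,W)`. -/
def E2fun (R₁ R₂ μ α : ℝ) (ξ : ℝ) (W : ℝ → ℝ) : ℝ :=
  (∫ r in R₁..R₂,
    (r * (2 * ξ ^ 2 + 1) * (deriv W r) ^ 2 + ((ξ ^ 2 - 1) ^ 2 / r) * (W r) ^ 2 +
      r * (deriv (deriv (rW W)) r) ^ 2)) +
  (1 - α / μ * R₁) * (deriv (rW W) R₁) ^ 2

/-- The functional `E₃(ξ,W) = −ξ² ∫_I g r W² Dρ̄ dr`. -/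
def E3fun (R₁ R₂ g : ℝ) (ρ : ℝ → ℝ) (ξ : ℝ) (W : ℝ → ℝ) : ℝ :=
  -(ξ ^ 2) * ∫ r in R₁..R₂, g * r * (W r) ^ 2 * deriv ρ r

/-- The functional `E(s,ξ,W) = μ s E₂(ξ,W) + E₃(ξ,W)`. -/
def Efun (R₁ R₂ μ α g : ℝ) (ρ : ℝ → ℝ) (s ξ : ℝ) (W : ℝ → ℝ) : ℝ :=
  μ * s * E2fun R₁ R₂ μ α ξ W + E3fun R₁ R₂ g ρ ξ W

/-- Admissible profile: `W ∈ C²`, `W(R₁) = W(R₂) = 0` and `DW(R₂) = 0`. -/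
def AdmW (R₁ R₂ : ℝ) (W : ℝ → ℝ) : Prop :=
  ContDiff ℝ 2 W ∧ W R₁ = 0 ∧ W R₂ = 0 ∧ deriv W R₂ = 0

/-- The set of values `E(s,ξ,W)/E₁(ξ,W)` over admissible, not identically zero, `W`. -/
def PhiSet (R₁ R₂ μ α g : ℝ) (ρ : ℝ → ℝ) (s ξ : ℝ) : Set ℝ :=
  {x : ℝ | ∃ W : ℝ → ℝ, AdmW R₁ R₂ W ∧ (∃ r ∈ Icc R₁ R₂, W r ≠ 0) ∧
    x = Efun R₁ R₂ μ α g ρ s ξ W / E1fun R₁ R₂ ρ ξ W}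

/-- `Φ(s,ξ) = inf { E(s,ξ,W)/E₁(ξ,W) : W admissible, W ≢ 0 }`. -/
def Phi (R₁ R₂ μ α g : ℝ) (ρ : ℝ → ℝ) (s ξ : ℝ) : ℝ :=
  sInf (PhiSet R₁ R₂ μ α g ρ s ξ)

/-- `λ_c(ξ) = sup { −E₃(ξ,W) : W admissible, μ E₂(ξ,W) = 1 }`. -/
def lamc (R₁ R₂ μ α g : ℝ) (ρ : ℝ → ℝ) (ξ : ℝ) : ℝ :=
  sSup {x : ℝ | ∃ W : ℝ → ℝ, AdmW R₁ R₂ W ∧ μ * E2fun R₁ R₂ μ α ξ W = 1 ∧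
    x = -E3fun R₁ R₂ g ρ ξ W}

lemma continuous_deriv_of_contDiff_two {f : ℝ → ℝ} (hf : ContDiff ℝ 2 f) :
    Continuous (deriv f) :=
  hf.continuous_deriv (by norm_num)

lemma continuous_deriv_deriv_of_contDiff_two {f : ℝ → ℝ} (hf : ContDiff ℝ 2 f) :
    Continuous (deriv (deriv f)) := by
  have h : ContDiff ℝ (1 + 1) f := by
    rw [one_add_one_eq_two]
    exact hf
  exact (contDiff_succ_iff_deriv.1 h).2.2.continuous_deriv le_rfl

lemma contDiff_rW {W : ℝ → ℝ} (hW : ContDiff ℝ 2 W) : ContDiff ℝ 2 (rW W) :=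
  contDiff_id.mul hW

/-- A Hardy type inequality for functions vanishing at both endpoints. -/
lemma integral_sq_le_integral_mul_deriv_sq {a b : ℝ} (ha : 0 < a) (hab : a < b) {W : ℝ → ℝ}
    (hW : ContDiff ℝ 2 W) (hWa : W a = 0) (hWb : W b = 0) :
    ∫ r in a..b, (W r) ^ 2 ≤ 4 * b * ∫ r in a..b, r * (deriv W r) ^ 2 := by
  have hc := hW.continuous
  have hd := continuous_deriv_of_contDiff_two hW
  have hftc : ∫ r in a..b, ((W r) ^ 2 + 2 * r * W r * deriv W r) = 0 := by
    rw [intervalIntegral.integral_eq_sub_of_hasDerivAt (f := fun r => r * (W r) ^ 2)]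
    · simp [hWa, hWb]
    · intro x _
      have h := (hasDerivAt_id x).mul
        (((hW.differentiable (by norm_num)) x).hasDerivAt.pow 2)
      refine h.congr_deriv ?_
      simp only [Pi.pow_apply, id_eq]
      push_cast
      ring
    · exact (by fun_prop : Continuous fun r => (W r) ^ 2 + 2 * r * W r * deriv W r)
        |>.intervalIntegrable _ _
  have hmono : ∫ r in a..b, (1 / 2 * (W r) ^ 2 - 2 * b * (r * (deriv W r) ^ 2)) ≤
      ∫ r in a..b, ((W r) ^ 2 + 2 * r * W r * deriv W r) := by
    refine intervalIntegral.integral_mono_on hab.le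
      (Continuous.intervalIntegrable (by fun_prop) _ _)
      (Continuous.intervalIntegrable (by fun_prop) _ _) fun r hr => ?_
    have h : r * (r * (deriv W r) ^ 2) ≤ b * (r * (deriv W r) ^ 2) :=
      mul_le_mul_of_nonneg_right hr.2 (mul_nonneg (ha.le.trans hr.1) (sq_nonneg _))
    nlinarith [sq_nonneg (W r + 2 * r * deriv W r)]
  rw [hftc, intervalIntegral.integral_sub (Continuous.intervalIntegrable (by fun_prop) _ _)
    (Continuous.intervalIntegrable (by fun_prop) _ _), intervalIntegral.integral_const_mul,
    intervalIntegral.integral_const_mul] at hmono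
  linarith

lemma integral_mul_deriv_sq_le_E2fun {R₁ R₂ μ α : ℝ} (hR₁ : 0 < R₁) (hR₁₂ : R₁ < R₂)
    (hα : 0 ≤ 1 - α * R₁ / μ) (ξ : ℝ) {W : ℝ → ℝ} (hW : ContDiff ℝ 2 W) :
    ∫ r in R₁..R₂, r * (deriv W r) ^ 2 ≤ E2fun R₁ R₂ μ α ξ W := by
  have hc := hW.continuous
  have hd := continuous_deriv_of_contDiff_two hW
  have hdd := continuous_deriv_deriv_of_contDiff_two (contDiff_rW hW)
  have hbdry : 0 ≤ (1 - α / μ * R₁) * (deriv (rW W) R₁) ^ 2 := by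
    rw [div_mul_eq_mul_div]
    exact mul_nonneg hα (sq_nonneg _)
  refine le_add_of_le_of_nonneg ?_ hbdry
  refine intervalIntegral.integral_mono_on hR₁₂.le
    (Continuous.intervalIntegrable (by fun_prop) _ _) ?_ fun r hr => ?_
  · refine ContinuousOn.intervalIntegrable_of_Icc hR₁₂.le ?_
    have hinv : ContinuousOn (fun r : ℝ => (ξ ^ 2 - 1) ^ 2 / r) (Icc R₁ R₂) :=
      continuousOn_const.div continuousOn_id fun r hr => (hR₁.trans_le hr.1).ne'
    fun_prop
  · have hr0 : 0 < r := hR₁.trans_le hr.1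
    have h₁ : 0 ≤ (ξ ^ 2 - 1) ^ 2 / r * (W r) ^ 2 := by positivity
    have h₂ : 0 ≤ r * (deriv (deriv (rW W)) r) ^ 2 := by positivity
    have h₃ : 0 ≤ 2 * ξ ^ 2 * (r * (deriv W r) ^ 2) := by positivity
    linarith

lemma E2fun_nonneg {R₁ R₂ μ α : ℝ} (hR₁ : 0 < R₁) (hR₁₂ : R₁ < R₂)
    (hα : 0 ≤ 1 - α * R₁ / μ) (ξ : ℝ) {W : ℝ → ℝ} (hW : ContDiff ℝ 2 W) :
    0 ≤ E2fun R₁ R₂ μ α ξ W :=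
  (intervalIntegral.integral_nonneg hR₁₂.le fun _ hr =>
    mul_nonneg (hR₁.le.trans hr.1) (sq_nonneg _)).trans
    (integral_mul_deriv_sq_le_E2fun hR₁ hR₁₂ hα ξ hW)

lemma E1fun_nonneg {R₁ R₂ : ℝ} (hR₁ : 0 < R₁) (hR₁₂ : R₁ < R₂) {ρ : ℝ → ℝ}
    (hρpos : ∀ r ∈ Icc R₁ R₂, 0 < ρ r) (ξ : ℝ) (W : ℝ → ℝ) : 0 ≤ E1fun R₁ R₂ ρ ξ W := by
  refine intervalIntegral.integral_nonneg hR₁₂.le fun r hr => ?_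
  have hr0 : 0 < r := hR₁.trans_le hr.1
  have hρr := hρpos r hr
  positivity

/-- The weighted mass controls the mass `∫ W²`. -/
lemma exists_integral_sq_le_E1fun {R₁ R₂ : ℝ} (hR₁ : 0 < R₁) (hR₁₂ : R₁ < R₂) {ρ : ℝ → ℝ}
    (hρ : Continuous ρ) (hρpos : ∀ r ∈ Icc R₁ R₂, 0 < ρ r) {ξ : ℝ} (hξ : ξ ≠ 0) :
    ∃ C : ℝ, 0 < C ∧ ∀ W : ℝ → ℝ, ContDiff ℝ 2 W →
      ∫ r in R₁..R₂, (W r) ^ 2 ≤ C * E1fun R₁ R₂ ρ ξ W := by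
  obtain ⟨m, hm, hmin⟩ := isCompact_Icc.exists_isMinOn (nonempty_Icc.2 hR₁₂.le) hρ.continuousOn
  have hρm := hρpos m hm
  have hk : 0 < ξ ^ 2 * R₁ * ρ m := by positivity
  refine ⟨(ξ ^ 2 * R₁ * ρ m)⁻¹, inv_pos.2 hk, fun W hW => ?_⟩
  have hc := hW.continuous
  have hd := continuous_deriv_of_contDiff_two (contDiff_rW hW)
  rw [le_inv_mul_iff₀ hk, ← intervalIntegral.integral_const_mul]
  refine intervalIntegral.integral_mono_on hR₁₂.le
    (Continuous.intervalIntegrable (by fun_prop) _ _)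
    (Continuous.intervalIntegrable (by fun_prop) _ _) fun r hr => ?_
  have hr0 : 0 < r := hR₁.trans_le hr.1
  have hρr := hρpos r hr
  have h₁ : ξ ^ 2 * R₁ * ρ m ≤ ξ ^ 2 * r * ρ r := by
    gcongr
    · exact hr.1
    · exact hmin hr
  have h₂ : 0 ≤ r * ρ r * (deriv (rW W) r) ^ 2 := by positivity
  nlinarith [mul_le_mul_of_nonneg_right h₁ (sq_nonneg (W r))]

/-- The mass `∫ W²` controls the buoyancy term. -/
lemma exists_neg_E3fun_le_integral_sq {R₁ R₂ g : ℝ} (hR₁ : 0 < R₁) (hR₁₂ : R₁ < R₂)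
    (hg : 0 < g) {ρ : ℝ → ℝ} (hρ : Continuous (deriv ρ)) {ξ : ℝ} (hξ : ξ ≠ 0) :
    ∃ C : ℝ, 0 < C ∧ ∀ W : ℝ → ℝ, ContDiff ℝ 2 W →
      -E3fun R₁ R₂ g ρ ξ W ≤ C * ∫ r in R₁..R₂, (W r) ^ 2 := by
  obtain ⟨K, hK⟩ := isCompact_Icc.exists_bound_of_continuousOn
    (hρ.continuousOn (s := Icc R₁ R₂))
  have hR₂ : 0 < R₂ := hR₁.trans hR₁₂
  have hK0 : 0 ≤ K := (norm_nonneg _).trans (hK R₁ (left_mem_Icc.2 hR₁₂.le))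
  refine ⟨ξ ^ 2 * (g * R₂ * (K + 1)), by positivity, fun W hW => ?_⟩
  have hc := hW.continuous
  rw [E3fun, neg_mul, neg_neg, mul_assoc]
  refine mul_le_mul_of_nonneg_left ?_ (sq_nonneg ξ)
  rw [← intervalIntegral.integral_const_mul]
  refine intervalIntegral.integral_mono_on hR₁₂.le
    (Continuous.intervalIntegrable (by fun_prop) _ _)
    (Continuous.intervalIntegrable (by fun_prop) _ _) fun r hr => ?_
  have hr0 : 0 < r := hR₁.trans_le hr.1
  have h₁ : deriv ρ r ≤ K + 1 := by
    have h := (le_abs_self _).trans (hK r hr)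
    linarith
  calc g * r * (W r) ^ 2 * deriv ρ r ≤ g * r * (W r) ^ 2 * (K + 1) := by gcongr
    _ ≤ g * R₂ * (W r) ^ 2 * (K + 1) := by
      gcongr
      exact hr.2
    _ = g * R₂ * (K + 1) * (W r) ^ 2 := by ring

lemma rW_const_mul (c : ℝ) (W : ℝ → ℝ) : rW (fun r => c * W r) = fun r => c * rW W r := by
  funext r
  simp only [rW]
  ring

lemma E2fun_const_mul (R₁ R₂ μ α ξ c : ℝ) (W : ℝ → ℝ) :
    E2fun R₁ R₂ μ α ξ (fun r => c * W r) = c ^ 2 * E2fun R₁ R₂ μ α ξ W := by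
  simp only [E2fun, rW_const_mul, deriv_const_mul_field', mul_add]
  congr 1
  · rw [← intervalIntegral.integral_const_mul]
    congr 1
    funext r
    ring
  · ring

lemma E3fun_const_mul (R₁ R₂ g : ℝ) (ρ : ℝ → ℝ) (ξ c : ℝ) (W : ℝ → ℝ) :
    E3fun R₁ R₂ g ρ ξ (fun r => c * W r) = c ^ 2 * E3fun R₁ R₂ g ρ ξ W := by
  rw [E3fun, E3fun, mul_left_comm, ← intervalIntegral.integral_const_mul (c ^ 2)]
  congr 2
  funext r
  ring

lemma AdmW.const_mul {R₁ R₂ : ℝ} {W : ℝ → ℝ} (hW : AdmW R₁ R₂ W) (c : ℝ) :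
    AdmW R₁ R₂ (fun r => c * W r) := by
  obtain ⟨h, h₁, h₂, h₃⟩ := hW
  exact ⟨contDiff_const.mul h, by simp [h₁], by simp [h₂], by simp [h₃]⟩

/-- Every admissible profile with positive `E₂` can be normalised. -/
lemma AdmW.exists_normalised {R₁ R₂ μ α g : ℝ} (hμ : 0 < μ) {ρ : ℝ → ℝ} {ξ : ℝ} {W : ℝ → ℝ}
    (hW : AdmW R₁ R₂ W) (hE₂ : 0 < E2fun R₁ R₂ μ α ξ W) :
    ∃ V : ℝ → ℝ, AdmW R₁ R₂ V ∧ μ * E2fun R₁ R₂ μ α ξ V = 1 ∧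
      -E3fun R₁ R₂ g ρ ξ W / (μ * E2fun R₁ R₂ μ α ξ W) = -E3fun R₁ R₂ g ρ ξ V := by
  have hpos : 0 < μ * E2fun R₁ R₂ μ α ξ W := mul_pos hμ hE₂
  have hsq : (√(μ * E2fun R₁ R₂ μ α ξ W))⁻¹ ^ 2 = (μ * E2fun R₁ R₂ μ α ξ W)⁻¹ := by
    rw [inv_pow, Real.sq_sqrt hpos.le]
  refine ⟨_, hW.const_mul (√(μ * E2fun R₁ R₂ μ α ξ W))⁻¹, ?_, ?_⟩
  · rw [E2fun_const_mul, hsq, mul_left_comm, inv_mul_cancel₀ hpos.ne']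
  · rw [E3fun_const_mul, hsq]
    ring

lemma exists_ne_zero_of_E3fun_neg {R₁ R₂ g : ℝ} (hR₁₂ : R₁ < R₂) {ρ : ℝ → ℝ} {ξ : ℝ}
    {W : ℝ → ℝ} (h : E3fun R₁ R₂ g ρ ξ W < 0) : ∃ r ∈ Icc R₁ R₂, W r ≠ 0 := by
  by_contra! hW
  have h₀ : ∫ r in R₁..R₂, g * r * (W r) ^ 2 * deriv ρ r = 0 := by
    rw [← intervalIntegral.integral_zero (a := R₁) (b := R₂) (μ := volume) (E := ℝ)]
    refine intervalIntegral.integral_congr fun r hr => ?_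
    rw [uIcc_of_le hR₁₂.le] at hr
    simp [hW r hr]
  rw [E3fun, h₀, mul_zero] at h
  exact h.false

/-- A bump supported where the density increases makes the buoyancy term negative. -/
lemma exists_admW_E3fun_neg {R₁ R₂ g : ℝ} (hR₁ : 0 < R₁) (hR₁₂ : R₁ < R₂)
    (hg : 0 < g) {ρ : ℝ → ℝ} (hρ : Continuous (deriv ρ)) {ξ : ℝ} (hξ : ξ ≠ 0)
    (hinst : ∃ rs ∈ Ioo R₁ R₂, 0 < deriv ρ rs) :
    ∃ W : ℝ → ℝ, AdmW R₁ R₂ W ∧ E3fun R₁ R₂ g ρ ξ W < 0 := by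
  obtain ⟨c, hc, hcpos⟩ := hinst
  have hnhds : Ioo R₁ R₂ ∩ {r | 0 < deriv ρ r} ∈ nhds c :=
    (isOpen_Ioo.inter (isOpen_lt continuous_const hρ)).mem_nhds ⟨hc, hcpos⟩
  obtain ⟨ε, hε, hball⟩ := Metric.mem_nhds_iff.1 hnhds
  let f : ContDiffBump c := ⟨ε / 4, ε / 2, by positivity, by linarith⟩
  have hsupp : tsupport f ⊆ Ioo R₁ R₂ ∩ {r | 0 < deriv ρ r} := by
    rw [f.tsupport_eq]
    exact (Metric.closedBall_subset_ball (by change ε / 2 < ε; linarith)).trans hball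
  have hoff : ∀ r, r ∉ Ioo R₁ R₂ ∩ {r | 0 < deriv ρ r} → f r = 0 := fun r hr =>
    image_eq_zero_of_notMem_tsupport fun h => hr (hsupp h)
  have hf₁ : f R₁ = 0 := hoff _ fun h => lt_irrefl _ h.1.1
  have hf₂ : f R₂ = 0 := hoff _ fun h => lt_irrefl _ h.1.2
  have hf₃ : deriv f R₂ = 0 := by
    by_contra h
    exact lt_irrefl _ (hsupp (support_deriv_subset h)).1.2
  refine ⟨f, ⟨f.contDiff, hf₁, hf₂, hf₃⟩, ?_⟩
  have hfc : Continuous f := f.continuous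
  have hint : 0 < ∫ r in R₁..R₂, g * r * (f r) ^ 2 * deriv ρ r := by
    refine intervalIntegral.integral_pos hR₁₂ (by fun_prop) (fun r hr => ?_)
      ⟨c, Ioo_subset_Icc_self hc, ?_⟩
    · have hr0 : 0 < r := hR₁.trans hr.1
      by_cases h : r ∈ Ioo R₁ R₂ ∩ {r | 0 < deriv ρ r}
      · have hr' : 0 < deriv ρ r := h.2
        positivity
      · simp [hoff r h]
    · have hc0 : 0 < c := hR₁.trans hc.1
      have hfpos : 0 < f c := f.pos_of_mem_ball (Metric.mem_ball_self f.rOut_pos)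
      positivity
  rw [E3fun]
  have hξ2 : 0 < ξ ^ 2 := by positivity
  nlinarith [mul_pos hξ2 hint]

theorem statement12 (R₁ R₂ μ α g : ℝ) (hR₁ : 0 < R₁) (hR₁₂ : R₁ < R₂) (hμ : 0 < μ)
    (hg : 0 < g) (hα : 0 ≤ 1 - α * R₁ / μ) (ρ : ℝ → ℝ) (hρ : ContDiff ℝ (⊤ : ℕ∞) ρ)
    (hρpos : ∀ r ∈ Icc R₁ R₂, 0 < ρ r)
    (hinst : ∃ rs ∈ Ioo R₁ R₂, 0 < deriv ρ rs) :
    ∀ ξ : ℝ, ξ ≠ 0 →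
      (∀ s : ℝ, 0 < s → s < lamc R₁ R₂ μ α g ρ ξ → Phi R₁ R₂ μ α g ρ s ξ < 0) ∧
      (∀ s : ℝ, lamc R₁ R₂ μ α g ρ ξ ≤ s → 0 ≤ Phi R₁ R₂ μ α g ρ s ξ) ∧
      Phi R₁ R₂ μ α g ρ (lamc R₁ R₂ μ α g ρ ξ) ξ = 0 := by
  intro ξ hξ
  have hR₂ : 0 < R₂ := hR₁.trans hR₁₂
  have hρ' : Continuous (deriv ρ) := hρ.continuous_deriv (by simp)
  obtain ⟨A, hA, hAE₁⟩ := exists_integral_sq_le_E1fun hR₁ hR₁₂ hρ.continuous hρpos hξ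
  obtain ⟨B, hB, hBE₃⟩ := exists_neg_E3fun_le_integral_sq hR₁ hR₁₂ hg hρ' hξ
  have hE₁ := E1fun_nonneg hR₁ hR₁₂ hρpos ξ
  have hE₃E₁ : ∀ W, AdmW R₁ R₂ W → -E3fun R₁ R₂ g ρ ξ W ≤ B * A * E1fun R₁ R₂ ρ ξ W :=
    fun W hW => by
      rw [mul_assoc]
      exact (hBE₃ W hW.1).trans (mul_le_mul_of_nonneg_left (hAE₁ W hW.1) hB.le)
  have hE₃E₂ : ∀ W, AdmW R₁ R₂ W →
      -E3fun R₁ R₂ g ρ ξ W ≤ B * (4 * R₂) * E2fun R₁ R₂ μ α ξ W := fun W hW => by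
    rw [mul_assoc]
    refine (hBE₃ W hW.1).trans (mul_le_mul_of_nonneg_left ?_ hB.le)
    exact (integral_sq_le_integral_mul_deriv_sq hR₁ hR₁₂ hW.1 hW.2.1 hW.2.2.1).trans
      (mul_le_mul_of_nonneg_left (integral_mul_deriv_sq_le_E2fun hR₁ hR₁₂ hα ξ hW.1)
        (by positivity))
  set S := {x : ℝ | ∃ W : ℝ → ℝ, AdmW R₁ R₂ W ∧ μ * E2fun R₁ R₂ μ α ξ W = 1 ∧
    x = -E3fun R₁ R₂ g ρ ξ W}
  have hlam : lamc R₁ R₂ μ α g ρ ξ = sSup S := rfl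
  have hSbdd : BddAbove S := by
    refine ⟨B * (4 * R₂) * μ⁻¹, ?_⟩
    rintro x ⟨W, hW, hnorm, rfl⟩
    rw [← eq_inv_of_mul_eq_one_right hnorm]
    exact hE₃E₂ W hW
  have hle : ∀ W, AdmW R₁ R₂ W →
      -E3fun R₁ R₂ g ρ ξ W ≤ lamc R₁ R₂ μ α g ρ ξ * (μ * E2fun R₁ R₂ μ α ξ W) := by
    intro W hW
    rcases (E2fun_nonneg hR₁ hR₁₂ hα ξ hW.1).eq_or_lt with h0 | hpos
    · have h := hE₃E₂ W hW
      rw [← h0] at h ⊢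
      simpa using h
    · rw [← div_le_iff₀ (mul_pos hμ hpos)]
      exact le_csSup hSbdd (hW.exists_normalised hμ hpos)
  obtain ⟨W₀, hW₀, hneg⟩ := exists_admW_E3fun_neg hR₁ hR₁₂ hg hρ' hξ hinst
  have hE₂W₀ : 0 < E2fun R₁ R₂ μ α ξ W₀ :=
    pos_of_mul_pos_right ((neg_pos.2 hneg).trans_le (hE₃E₂ W₀ hW₀)) (by positivity)
  have hSne : S.Nonempty := ⟨_, hW₀.exists_normalised hμ hE₂W₀⟩
  have hlampos : 0 < lamc R₁ R₂ μ α g ρ ξ :=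
    pos_of_mul_pos_left ((neg_pos.2 hneg).trans_le (hle W₀ hW₀)) (by positivity)
  have hPhiBdd : ∀ s, 0 < s → BddBelow (PhiSet R₁ R₂ μ α g ρ s ξ) := by
    refine fun s hs => ⟨-(B * A), ?_⟩
    rintro x ⟨W, hW, -, rfl⟩
    have hE₂ := E2fun_nonneg hR₁ hR₁₂ hα ξ hW.1
    have hE : -(B * A) * E1fun R₁ R₂ ρ ξ W ≤ Efun R₁ R₂ μ α g ρ s ξ W := by
      have h₁ := hE₃E₁ W hW
      have h₂ : 0 ≤ μ * s * E2fun R₁ R₂ μ α ξ W := by positivity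
      rw [Efun]
      linarith
    rcases (hE₁ W).eq_or_lt with h0 | hpos
    · rw [← h0, div_zero]
      exact neg_nonpos.2 (by positivity)
    · exact (le_div_iff₀ hpos).2 hE
  have hnonneg : ∀ s, lamc R₁ R₂ μ α g ρ ξ ≤ s → 0 ≤ Phi R₁ R₂ μ α g ρ s ξ := by
    refine fun s hs => Real.sInf_nonneg ?_
    rintro x ⟨W, hW, -, rfl⟩
    refine div_nonneg ?_ (hE₁ W)
    have h := mul_le_mul_of_nonneg_right hs
      (mul_nonneg hμ.le (E2fun_nonneg hR₁ hR₁₂ hα ξ hW.1))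
    have h' := hle W hW
    rw [Efun]
    linarith
  have hPhi : ∀ s t, 0 < s → 0 < t → t < lamc R₁ R₂ μ α g ρ ξ →
      ∃ W, 0 < E1fun R₁ R₂ ρ ξ W ∧ t ≤ B * A * E1fun R₁ R₂ ρ ξ W ∧
        Phi R₁ R₂ μ α g ρ s ξ * E1fun R₁ R₂ ρ ξ W < s - t := by
    intro s t hs ht hts
    obtain ⟨x, ⟨W, hW, hnorm, rfl⟩, hlt⟩ := exists_lt_of_lt_csSup hSne (hlam ▸ hts)
    have hE₃ := hE₃E₁ W hW
    have hpos : 0 < E1fun R₁ R₂ ρ ξ W :=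
      pos_of_mul_pos_right ((ht.trans hlt).trans_le hE₃) (by positivity)
    refine ⟨W, hpos, hlt.le.trans hE₃, ?_⟩
    have h : Phi R₁ R₂ μ α g ρ s ξ ≤ Efun R₁ R₂ μ α g ρ s ξ W / E1fun R₁ R₂ ρ ξ W :=
      csInf_le (hPhiBdd s hs)
        ⟨W, hW, exists_ne_zero_of_E3fun_neg hR₁₂ (neg_pos.1 (ht.trans hlt)), rfl⟩
    rw [le_div_iff₀ hpos, Efun, mul_right_comm, hnorm, one_mul] at h
    linarith
  refine ⟨fun s hs hsl => ?_, hnonneg, le_antisymm ?_ (hnonneg _ le_rfl)⟩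
  · obtain ⟨W, hpos, -, h⟩ := hPhi s s hs hs hsl
    rw [sub_self] at h
    exact neg_of_mul_neg_left h hpos.le
  · set L := lamc R₁ R₂ μ α g ρ ξ
    set P := Phi R₁ R₂ μ α g ρ L ξ
    by_contra! hP
    have hBA : 0 < B * A := by positivity
    set t := L * (B * A) / (P + B * A) with ht
    have htL : t < L := by
      rw [ht, div_lt_iff₀ (by positivity)]
      nlinarith
    obtain ⟨W, -, h₁, h₂⟩ := hPhi L t hlampos (by positivity) htL
    have ht' : t * (P + B * A) = L * (B * A) := div_mul_cancel₀ _ (by positivity)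
    nlinarith [mul_le_mul_of_nonneg_left h₁ hP.le, mul_lt_mul_of_pos_left h₂ hBA]

end
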